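/- (Holshouser–Jackson) E_0 has the 2-Mycielski property: for every comeager set C ⊆ 2^ω × 2^ω there exists an E_0-tree map Φ such that every pair (a, b) ∈ range(Φ) × range(Φ) with ¬(a E_0 b) belongs to C. (Since range(Φ) is Borel and Φ is a Borel reduction of E_0 into E_0 ↾ range(Φ), this witnesses the 2-Mycielski property for E_0.) -/

import Mathlib

open Set Function

/-- The eventual-agreement equivalence relation `E₀`: `x E₀ y` iff `∃ n ∀ k > n, x k = y k`. -/
def E0 {α : Type*} (x y : ℕ → α) : Prop := ∃ n, ∀ k > n, x k = y k

/-- The finite initial segment `s ⌢ v 0 (x 0) ⌢ ⋯ ⌢ v (n-1) (x (n-1))`. -/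
def blockPrefix (s : List Bool) (v : ℕ → Bool → List Bool) (x : ℕ → Bool) : ℕ → List Bool
  | 0 => s
  | n + 1 => blockPrefix s v x n ++ v n (x n)

/-- The map `x ↦ s ⌢ v 0 (x 0) ⌢ v 1 (x 1) ⌢ ⋯` determined by a stem `s` and blocks `v`. -/
def e0TreeMapOf (s : List Bool) (v : ℕ → Bool → List Bool) (x : ℕ → Bool) : ℕ → Bool :=
  fun m => (blockPrefix s v x (m + 1)).getD m false

/-- Conditions on the blocks of an `E₀`-tree: `v n i` starts with `i` and the two blocks at
each level have equal length. -/
def IsE0Blocks (v : ℕ → Bool → List Bool) : Prop :=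
  (∀ n i, (v n i).head? = some i) ∧ ∀ n, (v n false).length = (v n true).length

/-- `Φ` is an `E₀`-tree map: `Φ(x) = s ⌢ v_0^{x(0)} ⌢ v_1^{x(1)} ⌢ ⋯`. -/
def IsE0TreeMap (Φ : (ℕ → Bool) → (ℕ → Bool)) : Prop :=
  ∃ s v, IsE0Blocks v ∧ Φ = e0TreeMapOf s v

/-- The basic open set of all sequences extending the finite string `p`. -/
def listCylinder (p : List Bool) : Set (ℕ → Bool) :=
  PiNat.cylinder (fun i => p.getD i false) p.length

theorem mem_listCylinder {p : List Bool} {x : ℕ → Bool} :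
    x ∈ listCylinder p ↔ ∀ i < p.length, x i = p.getD i false :=
  Iff.rfl

theorem listCylinder_append_subset (p c : List Bool) :
    listCylinder (p ++ c) ⊆ listCylinder p := by
  refine fun x hx => mem_listCylinder.2 fun i hi => ?_
  rw [mem_listCylinder.1 hx i (by simp; omega), List.getD_append _ _ _ _ hi]

theorem exists_cylinder_subset_of_isOpen {U : Set (ℕ → Bool)} (hU : IsOpen U) {x : ℕ → Bool}
    (hx : x ∈ U) : ∃ n, PiNat.cylinder x n ⊆ U := by
  obtain ⟨_, ⟨z, n, rfl⟩, hxz, hzU⟩ :=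
    (PiNat.isTopologicalBasis_cylinders fun _ => Bool).exists_subset_of_mem_open hx hU
  exact ⟨n, (PiNat.mem_cylinder_iff_eq.1 hxz).symm ▸ hzU⟩

/-- A string extended by the next `n` values of a sequence through it. -/
theorem listCylinder_append_ofFn_subset {p : List Bool} {x : ℕ → Bool} (hx : x ∈ listCylinder p)
    (n : ℕ) :
    listCylinder (p ++ List.ofFn fun i : Fin n => x (p.length + i)) ⊆ PiNat.cylinder x n := by
  intro y hy i hi
  rw [mem_listCylinder.1 hy i (by simp; omega)]
  rcases lt_or_ge i p.length with h | h
  · rw [List.getD_append _ _ _ _ h, mem_listCylinder.1 hx i h]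
  · rw [List.getD_append_right _ _ _ _ h, List.getD_eq_getElem _ _ (by simp; omega)]
    simp [h]

theorem exists_append_prod_subset {D : Set ((ℕ → Bool) × (ℕ → Bool))} (hD : IsOpen D)
    (hD' : Dense D) (p q : List Bool) :
    ∃ c d : List Bool, c.length = d.length ∧
      listCylinder (p ++ c) ×ˢ listCylinder (q ++ d) ⊆ D := by
  obtain ⟨⟨x, y⟩, ⟨hx, hy⟩, hxy⟩ := hD'.inter_open_nonempty
    (listCylinder p ×ˢ listCylinder q)
    ((PiNat.isOpen_cylinder _ _ _).prod (PiNat.isOpen_cylinder _ _ _))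
    ⟨(_, _), PiNat.self_mem_cylinder _ _, PiNat.self_mem_cylinder _ _⟩
  obtain ⟨U, V, hU, hV, hxU, hyV, hUV⟩ := isOpen_prod_iff.1 hD x y hxy
  obtain ⟨m, hm⟩ := exists_cylinder_subset_of_isOpen hU hxU
  obtain ⟨n, hn⟩ := exists_cylinder_subset_of_isOpen hV hyV
  refine ⟨List.ofFn fun i : Fin (max m n) => x (p.length + i),
    List.ofFn fun i : Fin (max m n) => y (q.length + i), by simp, ?_⟩
  refine (prod_mono ?_ ?_).trans hUV
  · exact (listCylinder_append_ofFn_subset hx _).trans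
      ((PiNat.cylinder_anti x (le_max_left m n)).trans hm)
  · exact (listCylinder_append_ofFn_subset hy _).trans
      ((PiNat.cylinder_anti y (le_max_right m n)).trans hn)

theorem exists_append_prod_subset_of_finite {D : Set ((ℕ → Bool) × (ℕ → Bool))} (hD : IsOpen D)
    (hD' : Dense D) {S : Set (List Bool × List Bool)} (hS : S.Finite) :
    ∃ c d : List Bool, c.length = d.length ∧
      ∀ r ∈ S, listCylinder (r.1 ++ c) ×ˢ listCylinder (r.2 ++ d) ⊆ D := by
  induction S, hS using Set.Finite.induction_on with
  | empty => exact ⟨[], [], rfl, by simp⟩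
  | @insert r S _ _ ih =>
    obtain ⟨c, d, hcd, h⟩ := ih
    obtain ⟨c', d', hcd', h'⟩ := exists_append_prod_subset hD hD' (r.1 ++ c) (r.2 ++ d)
    refine ⟨c ++ c', d ++ d', by simp [hcd, hcd'], ?_⟩
    simp only [← List.append_assoc]
    rintro t (rfl | ht)
    · exact h'
    · exact (prod_mono (listCylinder_append_subset _ _) (listCylinder_append_subset _ _)).trans
        (h t ht)

/-- Equal-length strings that, appended to any two strings of length `l`, force membership of
both orders of the pair in `D`. -/
theorem exists_blocks_tail {D : Set ((ℕ → Bool) × (ℕ → Bool))} (hD : IsOpen D)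
    (hD' : Dense D) (l : ℕ) :
    ∃ w : Bool → List Bool, (w false).length = (w true).length ∧
      ∀ p q : List Bool, p.length = l → q.length = l → ∀ i j, i ≠ j →
        listCylinder (p ++ w i) ×ˢ listCylinder (q ++ w j) ⊆ D := by
  have hswap : IsOpen (Prod.swap ⁻¹' D) := hD.preimage continuous_swap
  have hswap' : Dense (Prod.swap ⁻¹' D) :=
    hD'.preimage (Homeomorph.prodComm (ℕ → Bool) (ℕ → Bool)).isOpenMap
  have hfin : {p : List Bool | p.length = l}.Finite := List.finite_length_eq Bool l
  obtain ⟨c, d, hcd, h⟩ := exists_append_prod_subset_of_finite (hD.inter hswap)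
    (hD'.inter_of_isOpen_left hswap' hD) (hfin.prod hfin)
  refine ⟨fun i => cond i d c, hcd, fun p q hp hq i j hij => ?_⟩
  rintro ⟨x, y⟩ ⟨hx, hy⟩
  cases i <;> cases j
  · exact absurd rfl hij
  · exact (h (p, q) ⟨hp, hq⟩ (show (x, y) ∈ _ from ⟨hx, hy⟩)).1
  · exact (h (q, p) ⟨hq, hp⟩ (show (y, x) ∈ _ from ⟨hy, hx⟩)).2
  · exact absurd rfl hij

theorem exists_isE0Blocks_prod_subset {D : ℕ → Set ((ℕ → Bool) × (ℕ → Bool))}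
    (hD : ∀ n, IsOpen (D n)) (hD' : ∀ n, Dense (D n)) :
    ∃ v, IsE0Blocks v ∧ ∀ (x y : ℕ → Bool) (n : ℕ), x n ≠ y n →
      listCylinder (blockPrefix [] v x (n + 1)) ×ˢ listCylinder (blockPrefix [] v y (n + 1))
        ⊆ D n := by
  choose w hw hwD using fun n l => exists_blocks_tail (hD n) (hD' n) (l + 1)
  let l : ℕ → ℕ := fun n => Nat.rec 0 (fun n l => l + (1 + (w n l false).length)) n
  let v : ℕ → Bool → List Bool := fun n i => i :: w n (l n) i
  have hlen : ∀ (x : ℕ → Bool) (n : ℕ), (blockPrefix [] v x n).length = l n := by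
    intro x n
    induction n with
    | zero => rfl
    | succ n ih =>
      have hx : (w n (l n) (x n)).length = (w n (l n) false).length := by
        cases x n
        · rfl
        · exact (hw n (l n)).symm
      change (blockPrefix [] v x n ++ x n :: w n (l n) (x n)).length
        = l n + (1 + (w n (l n) false).length)
      rw [List.length_append, ih, List.length_cons, hx, add_comm 1]
  refine ⟨v, ⟨fun n i => rfl, fun n => by simp [v, hw]⟩, fun x y n hxy => ?_⟩
  have := hwD n (l n) (blockPrefix [] v x n ++ [x n]) (blockPrefix [] v y n ++ [y n])
    (by simp [hlen]) (by simp [hlen]) _ _ hxy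
  simpa [blockPrefix, v] using this

section IsE0Blocks

variable {s : List Bool} {v : ℕ → Bool → List Bool}

theorem IsE0Blocks.length_eq (hv : IsE0Blocks v) (n : ℕ) (i j : Bool) :
    (v n i).length = (v n j).length := by
  cases i <;> cases j <;> simp [hv.2 n]

theorem IsE0Blocks.length_blockPrefix_eq (hv : IsE0Blocks v) (x y : ℕ → Bool) (n : ℕ) :
    (blockPrefix s v x n).length = (blockPrefix s v y n).length := by
  induction n with
  | zero => rfl
  | succ n ih => simp [blockPrefix, ih, hv.length_eq n (x n) (y n)]

theorem IsE0Blocks.le_length_blockPrefix (hv : IsE0Blocks v) (x : ℕ → Bool) (n : ℕ) :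
    n ≤ (blockPrefix s v x n).length := by
  induction n with
  | zero => simp
  | succ n ih =>
    have : v n (x n) ≠ [] := fun h => by simpa [h] using hv.1 n (x n)
    have := List.length_pos_iff.2 this
    simp only [blockPrefix, List.length_append]
    omega

theorem blockPrefix_prefix (x : ℕ → Bool) {m n : ℕ} (h : m ≤ n) :
    blockPrefix s v x m <+: blockPrefix s v x n := by
  induction n, h using Nat.le_induction with
  | base => exact List.prefix_rfl
  | succ n _ ih => exact ih.trans (List.prefix_append _ _)

theorem IsE0Blocks.e0TreeMapOf_mem_listCylinder (hv : IsE0Blocks v) (x : ℕ → Bool) (n : ℕ) :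
    e0TreeMapOf s v x ∈ listCylinder (blockPrefix s v x n) := by
  refine mem_listCylinder.2 fun i hi => ?_
  have hi' := hv.le_length_blockPrefix (s := s) x (i + 1)
  rcases le_total (i + 1) n with h | h
  · obtain ⟨t, ht⟩ := blockPrefix_prefix (s := s) (v := v) x h
    rw [← ht, List.getD_append _ _ _ _ hi']
    rfl
  · obtain ⟨t, ht⟩ := blockPrefix_prefix (s := s) (v := v) x h
    rw [← List.getD_append _ t _ _ hi, ht]
    rfl

theorem IsE0Blocks.E0_e0TreeMapOf (hv : IsE0Blocks v) {x y : ℕ → Bool} {N : ℕ}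
    (h : ∀ n ≥ N, x n = y n) : E0 (e0TreeMapOf s v x) (e0TreeMapOf s v y) := by
  have key : ∀ n ≥ N, ∀ i ≥ (blockPrefix s v x N).length,
      (blockPrefix s v x n).getD i false = (blockPrefix s v y n).getD i false := by
    intro n hn
    induction n, hn using Nat.le_induction with
    | base =>
      intro i hi
      rw [List.getD_eq_default _ _ hi,
        List.getD_eq_default _ _ (hv.length_blockPrefix_eq y x N ▸ hi)]
    | succ n hn ih =>
      intro i hi
      have hlen := hv.length_blockPrefix_eq (s := s) x y n
      simp only [blockPrefix, h n hn]
      rcases lt_or_ge i (blockPrefix s v x n).length with h' | h'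
      · rw [List.getD_append _ _ _ _ h', List.getD_append _ _ _ _ (hlen ▸ h'), ih i hi]
      · rw [List.getD_append_right _ _ _ _ h', List.getD_append_right _ _ _ _ (hlen ▸ h'), hlen]
  refine ⟨(blockPrefix s v x N).length, fun k hk => key (k + 1) ?_ k hk.le⟩
  have := hv.le_length_blockPrefix (s := s) x N
  omega

end IsE0Blocks

/-- A comeager set contains the intersection of a decreasing sequence of dense open sets. -/
theorem exists_antitone_isOpen_dense_of_mem_residual {X : Type*} [TopologicalSpace X]
    [BaireSpace X] {C : Set X} (hC : C ∈ residual X) :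
    ∃ D : ℕ → Set X, Antitone D ∧ (∀ n, IsOpen (D n)) ∧ (∀ n, Dense (D n)) ∧ ⋂ n, D n ⊆ C := by
  obtain ⟨S, hSo, hSd, hSc, hSC⟩ := mem_residual_iff.1 hC
  obtain ⟨f, hf⟩ := (hSc.insert univ).exists_eq_range (insert_nonempty _ _)
  have hfo : ∀ n, IsOpen (f n) := by
    intro n
    rcases hf ▸ mem_range_self n with h | h
    · exact h ▸ isOpen_univ
    · exact hSo _ h
  have hfd : ∀ n, Dense (f n) := by
    intro n
    rcases hf ▸ mem_range_self n with h | h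
    · exact h ▸ dense_univ
    · exact hSd _ h
  refine ⟨fun n => ⋂ i ∈ Iic n, f i, fun m n h => biInter_mono (Iic_subset_Iic.2 h) fun _ _ =>
    Subset.rfl, fun n => (finite_Iic n).isOpen_biInter fun i _ => hfo i,
    fun n => dense_biInter_of_isOpen (fun i _ => hfo i) (to_countable _) fun i _ => hfd i, ?_⟩
  refine fun x hx => hSC fun t ht => ?_
  obtain ⟨n, rfl⟩ : t ∈ range f := hf ▸ mem_insert_of_mem _ ht
  exact mem_iInter₂.1 (mem_iInter.1 hx n) n (mem_Iic.2 le_rfl)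

/-- (Holshouser–Jackson) `E₀` has the 2-Mycielski property: every comeager subset of
`2^ω × 2^ω` contains all pairs of `E₀`-inequivalent points from the range of some
`E₀`-tree map. -/
theorem e0_two_mycielski (C : Set ((ℕ → Bool) × (ℕ → Bool)))
    (hC : C ∈ residual ((ℕ → Bool) × (ℕ → Bool))) :
    ∃ Φ : (ℕ → Bool) → (ℕ → Bool), IsE0TreeMap Φ ∧
      ∀ a ∈ range Φ, ∀ b ∈ range Φ, ¬E0 a b → (a, b) ∈ C := by
  obtain ⟨D, hanti, hDo, hDd, hDC⟩ := exists_antitone_isOpen_dense_of_mem_residual hC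
  obtain ⟨v, hv, hvD⟩ := exists_isE0Blocks_prod_subset hDo hDd
  refine ⟨e0TreeMapOf [] v, ⟨[], v, hv, rfl⟩, ?_⟩
  rintro _ ⟨x, rfl⟩ _ ⟨y, rfl⟩ hxy
  refine hDC (mem_iInter.2 fun N => ?_)
  obtain ⟨n, hn, hne⟩ : ∃ n ≥ N, x n ≠ y n := by
    by_contra! h
    exact hxy (hv.E0_e0TreeMapOf h)
  exact hanti hn (hvD x y n hne
    ⟨hv.e0TreeMapOf_mem_listCylinder x _, hv.e0TreeMapOf_mem_listCylinder y _⟩)
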